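/- Let Z : ℝ → M₂(ℝ) satisfy Z(s)ᵀ = Z(s) for all s, and let D₁, D₂ : ℝ → M₂(ℝ) be twice differentiable with Dᵢ''(s) = Dᵢ(s)·Z(s) for all s and i = 1, 2. Then the derivative of the function s ↦ D₁'(s)·D₂(s)ᵀ − D₁(s)·D₂'(s)ᵀ vanishes identically, i.e. this matrix-valued function is constant on ℝ. -/

import Mathlib

open Matrix

noncomputable section

attribute [local instance] Matrix.normedAddCommGroup Matrix.normedSpace

lemma HasDerivAt.matrix_mul {l m n : Type*} [Fintype l] [Fintype m] [Fintype n]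
    {A : ℝ → Matrix l m ℝ} {B : ℝ → Matrix m n ℝ} {A' : Matrix l m ℝ} {B' : Matrix m n ℝ} {s : ℝ}
    (hA : HasDerivAt A A' s) (hB : HasDerivAt B B' s) :
    HasDerivAt (fun u => A u * B u) (A' * B s + A s * B') s := by
  refine hasDerivAt_pi.2 fun i => hasDerivAt_pi.2 fun j => ?_
  have h : HasDerivAt (fun u => ∑ k, A u i k * B u k j)
      (∑ k, (A' i k * B s k j + A s i k * B' k j)) s :=
    HasDerivAt.fun_sum fun k _ =>
      (hasDerivAt_pi.1 (hasDerivAt_pi.1 hA i) k).mul (hasDerivAt_pi.1 (hasDerivAt_pi.1 hB k) j)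
  simpa only [Matrix.mul_apply, Matrix.add_apply, Finset.sum_add_distrib] using h

lemma HasDerivAt.matrix_transpose {m n : Type*} [Fintype m] [Fintype n]
    {A : ℝ → Matrix m n ℝ} {A' : Matrix m n ℝ} {s : ℝ} (hA : HasDerivAt A A' s) :
    HasDerivAt (fun u => (A u)ᵀ) A'ᵀ s :=
  hasDerivAt_pi.2 fun i => hasDerivAt_pi.2 fun j =>
    hasDerivAt_pi.1 (hasDerivAt_pi.1 hA j) i

/-- Two solutions of the matrix Jacobi equation with symmetric tidal matrix have a matrix Wronskian
of zero derivative. -/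
lemma hasDerivAt_matrix_wronskian {n : Type*} [Fintype n] {D₁ D₂ E₁ E₂ : ℝ → Matrix n n ℝ}
    {Z : Matrix n n ℝ} {s : ℝ} (hZ : Zᵀ = Z)
    (hD₁ : HasDerivAt D₁ (E₁ s) s) (hE₁ : HasDerivAt E₁ (D₁ s * Z) s)
    (hD₂ : HasDerivAt D₂ (E₂ s) s) (hE₂ : HasDerivAt E₂ (D₂ s * Z) s) :
    HasDerivAt (fun u => E₁ u * (D₂ u)ᵀ - D₁ u * (E₂ u)ᵀ) 0 s := by
  refine ((hE₁.matrix_mul hD₂.matrix_transpose).sub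
    (hD₁.matrix_mul hE₂.matrix_transpose)).congr_deriv ?_
  rw [transpose_mul, hZ, Matrix.mul_assoc]
  abel

/-- Conservation law for Jacobi matrices of light bundles (vacuum form). -/
theorem jacobi_matrix_conservation
    (Z : ℝ → Matrix (Fin 2) (Fin 2) ℝ) (hZ : ∀ s, (Z s)ᵀ = Z s)
    (D₁ D₂ : ℝ → Matrix (Fin 2) (Fin 2) ℝ)
    (hD1 : Differentiable ℝ D₁) (hD1' : Differentiable ℝ (deriv D₁))
    (hD2 : Differentiable ℝ D₂) (hD2' : Differentiable ℝ (deriv D₂))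
    (hJac1 : ∀ s, deriv (deriv D₁) s = D₁ s * Z s)
    (hJac2 : ∀ s, deriv (deriv D₂) s = D₂ s * Z s) :
    (∀ s, deriv (fun u => deriv D₁ u * (D₂ u)ᵀ - D₁ u * (deriv D₂ u)ᵀ) s = 0) ∧
    (∀ s t, deriv D₁ s * (D₂ s)ᵀ - D₁ s * (deriv D₂ s)ᵀ
          = deriv D₁ t * (D₂ t)ᵀ - D₁ t * (deriv D₂ t)ᵀ) := by
  have hW : ∀ s, HasDerivAt (fun u => deriv D₁ u * (D₂ u)ᵀ - D₁ u * (deriv D₂ u)ᵀ) 0 s :=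
    fun s => hasDerivAt_matrix_wronskian (hZ s)
      (hD1 s).hasDerivAt ((hD1' s).hasDerivAt.congr_deriv (hJac1 s))
      (hD2 s).hasDerivAt ((hD2' s).hasDerivAt.congr_deriv (hJac2 s))
  exact ⟨fun s => (hW s).deriv, is_const_of_deriv_eq_zero
    (fun s => (hW s).differentiableAt) fun s => (hW s).deriv⟩
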